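/- arXiv:1211.0981 — 2 statements merged into one kernel-verified Lean document; each statement's English description precedes it below -/
import Mathlib

section
/- Let K be a field of characteristic zero, n ≥ 1, and B_n the homogenized Weyl algebra over K. Let A be a 2n×2n matrix over K, let ρ = (μ_1,…,μ_n,ν_1,…,ν_n) ∈ K^{2n}, and let λ ∈ K with λ ≠ 0. Define σ on the degree-one generators of B_n by σ(X_j) = Σ_{i=1}^n A_{2i−1,2j−1}·X_i + Σ_{i=1}^n A_{2i,2j−1}·Y_i + μ_j·Z, σ(Y_k) = Σ_{ℓ=1}^n A_{2ℓ−1,2k}·X_ℓ + Σ_{ℓ=1}^n A_{2ℓ,2k}·Y_ℓ + ν_k·Z, and σ(Z) = λ·Z. Then σ extends to a K-algebra automorphism of B_n if and only if the following hold: (1) Σ_{i=1}^n det[[A_{2i−1,2j−1}, A_{2i−1,2k−1}],[A_{2i,2j−1}, A_{2i,2k−1}]] = 0 for all 1 ≤ j < k ≤ n; (2) Σ_{i=1}^n det[[A_{2i−1,2j}, A_{2i−1,2k}],[A_{2i,2j}, A_{2i,2k}]] = 0 for all 1 ≤ j < k ≤ n; (3) Σ_{i=1}^n det[[A_{2i−1,2j−1},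 A_{2i−1,2j}],[A_{2i,2j−1}, A_{2i,2j}]] = λ^2 for all 1 ≤ j ≤ n; (4) Σ_{i=1}^n det[[A_{2i−1,2j−1}, A_{2i−1,2k}],[A_{2i,2j−1}, A_{2i,2k}]] = 0 for all 1 ≤ j, k ≤ n with j ≠ k. -/
/-! Prelude: the homogenized Weyl algebra `B_n`. -/

noncomputable section

/-- Generators of the homogenized Weyl algebra `B_n`:
`X 0, …, X (n-1)`, `Y 0, …, Y (n-1)` and `Z`. -/
inductive BGen (n : ℕ) : Type
  | X : Fin n → BGen n
  | Y : Fin n → BGen n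
  | Z : BGen n

/-- The defining relations of the homogenized Weyl algebra `B_n`:
`X_i Y_j = Y_j X_i + δ_{ij} Z²`, `X_i X_j = X_j X_i`, `Y_i Y_j = Y_j Y_i`,
`X_i Z = Z X_i`, `Y_i Z = Z Y_i`. -/
inductive BRel (K : Type) [CommRing K] (n : ℕ) :
    FreeAlgebra K (BGen n) → FreeAlgebra K (BGen n) → Prop
  | xy (i j : Fin n) : BRel K n (FreeAlgebra.ι K (BGen.X i) * FreeAlgebra.ι K (BGen.Y j))
      (FreeAlgebra.ι K (BGen.Y j) * FreeAlgebra.ι K (BGen.X i) +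
        if i = j then (FreeAlgebra.ι K (BGen.Z : BGen n)) ^ 2 else 0)
  | xx (i j : Fin n) : BRel K n (FreeAlgebra.ι K (BGen.X i) * FreeAlgebra.ι K (BGen.X j))
      (FreeAlgebra.ι K (BGen.X j) * FreeAlgebra.ι K (BGen.X i))
  | yy (i j : Fin n) : BRel K n (FreeAlgebra.ι K (BGen.Y i) * FreeAlgebra.ι K (BGen.Y j))
      (FreeAlgebra.ι K (BGen.Y j) * FreeAlgebra.ι K (BGen.Y i))
  | xz (i : Fin n) : BRel K n (FreeAlgebra.ι K (BGen.X i) * FreeAlgebra.ι K (BGen.Z : BGen n))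
      (FreeAlgebra.ι K (BGen.Z : BGen n) * FreeAlgebra.ι K (BGen.X i))
  | yz (i : Fin n) : BRel K n (FreeAlgebra.ι K (BGen.Y i) * FreeAlgebra.ι K (BGen.Z : BGen n))
      (FreeAlgebra.ι K (BGen.Z : BGen n) * FreeAlgebra.ι K (BGen.Y i))

/-- The homogenized Weyl algebra `B_n` over `K`. -/
def HWeyl (K : Type) [CommRing K] (n : ℕ) : Type := RingQuot (BRel K n)

instance (K : Type) [CommRing K] (n : ℕ) : Ring (HWeyl K n) :=
  inferInstanceAs (Ring (RingQuot (BRel K n)))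

instance (K : Type) [CommRing K] (n : ℕ) : Algebra K (HWeyl K n) :=
  inferInstanceAs (Algebra K (RingQuot (BRel K n)))

/-- The canonical degree-one generators of `B_n`. -/
def HWeyl.gen (K : Type) [CommRing K] {n : ℕ} (w : BGen n) : HWeyl K n :=
  RingQuot.mkAlgHom K (BRel K n) (FreeAlgebra.ι K w)

/-- A `K`-algebra automorphism of `B_n` is *grade preserving* provided it maps the span of
the degree one generators into itself (as `B_n` is generated in degree one, this is
equivalent to preserving every homogeneous component). -/
def HWeyl.GradePreserving {K : Type} [CommRing K] {n : ℕ}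
    (f : HWeyl K n ≃ₐ[K] HWeyl K n) : Prop :=
  ∀ w : BGen n, f (HWeyl.gen K w) ∈ Submodule.span K (Set.range (HWeyl.gen K (n := n)))


/-- Position `2i-1` (1-based) among the rows/columns of a `2n × 2n` matrix,
i.e. the row/column carrying the `X_i`-coefficients. -/
def oddIdx {n : ℕ} (i : Fin n) : Fin (2 * n) := ⟨2 * (i : ℕ), by have := i.isLt; omega⟩

/-- Position `2i` (1-based) among the rows/columns of a `2n × 2n` matrix,
i.e. the row/column carrying the `Y_i`-coefficients. -/
def evenIdx {n : ℕ} (i : Fin n) : Fin (2 * n) := ⟨2 * (i : ℕ) + 1, by have := i.isLt; omega⟩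

namespace HWeyl

open Matrix

attribute [local instance] LieRing.ofAssociativeRing

variable {K : Type} {n : ℕ}

/-- A family `x`, indexed by `X_1, …, X_n, Y_1, …, Y_n`, and an element `z` satisfy the
defining relations of the homogenized Weyl algebra. -/
structure IsWeylFamily [CommRing K] {B : Type*} [Ring B] [Algebra K B]
    (x : Fin n ⊕ Fin n → B) (z : B) : Prop where
  lie (a b) : ⁅x b, x a⁆ = J (Fin n) K a b • z ^ 2
  lie_z (a) : ⁅x a, z⁆ = 0

/-- The generators `X_1, …, X_n, Y_1, …, Y_n` as one family. -/
def xy (K : Type) [CommRing K] {n : ℕ} : Fin n ⊕ Fin n → HWeyl K n :=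
  Sum.elim (fun i => gen K (.X i)) (fun i => gen K (.Y i))

/-- The generator `Z`. -/
def z (K : Type) [CommRing K] (n : ℕ) : HWeyl K n := gen K .Z

section Universal

variable [CommRing K] {B : Type*} [Ring B] [Algebra K B]

theorem isWeylFamily_xy : IsWeylFamily (K := K) (xy K (n := n)) (z K n) := by
  let mk : FreeAlgebra K (BGen n) →ₐ[K] HWeyl K n := RingQuot.mkAlgHom K (BRel K n)
  have key {u v} (h : BRel K n u v) : mk u = mk v := RingQuot.mkAlgHom_rel K h
  have hmk (t) : mk (FreeAlgebra.ι K t) = gen K t := rfl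
  constructor
  · rintro (i | i) (j | j)
    · simpa [xy, Ring.lie_def, J, sub_eq_zero, hmk] using key (.xx j i)
    · have : (gen K (.X i) * gen K (.Y j) : HWeyl K n) =
          gen K (.Y j) * gen K (.X i) + if i = j then z K n ^ 2 else 0 := by
        have := key (.xy i j)
        rwa [map_add, apply_ite mk, map_mul, map_mul, map_pow, map_zero] at this
      simp [Ring.lie_def, xy, J, one_apply, ite_smul, this]
    · have : (gen K (.X j) * gen K (.Y i) : HWeyl K n) =
          gen K (.Y i) * gen K (.X j) + if j = i then z K n ^ 2 else 0 := by
        have := key (.xy j i)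
        rwa [map_add, apply_ite mk, map_mul, map_mul, map_pow, map_zero] at this
      simp [Ring.lie_def, xy, J, one_apply, ite_smul, this, @eq_comm _ i j]
    · simpa [xy, Ring.lie_def, J, sub_eq_zero, hmk] using key (.yy j i)
  · rintro (i | i)
    · simpa [xy, z, Ring.lie_def, sub_eq_zero, hmk] using key (.xz i)
    · simpa [xy, z, Ring.lie_def, sub_eq_zero, hmk] using key (.yz i)

/-- The universal property of the homogenized Weyl algebra. -/
theorem exists_algHom {x : Fin n ⊕ Fin n → B} {w : B} (h : IsWeylFamily (K := K) x w) :
    ∃ f : HWeyl K n →ₐ[K] B, (∀ a, f (xy K a) = x a) ∧ f (z K n) = w := by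
  let g : BGen n → B := fun t => match t with
    | .X i => x (.inl i)
    | .Y i => x (.inr i)
    | .Z => w
  have hg : ∀ ⦃u v⦄, BRel K n u v → FreeAlgebra.lift K g u = FreeAlgebra.lift K g v := by
    have hl (a b) := h.lie a b
    have hz (a) := h.lie_z a
    simp only [Ring.lie_def, sub_eq_zero] at hz
    simp only [Ring.lie_def] at hl
    rintro _ _ (⟨i, j⟩ | ⟨i, j⟩ | ⟨i, j⟩ | i | i)
    · have := hl (.inr j) (.inl i)
      simp only [J, fromBlocks_apply₂₁, one_apply, ite_smul, one_smul, zero_smul,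
        @eq_comm _ j i, sub_eq_iff_eq_add'] at this
      simpa [g, apply_ite] using this
    · simpa [g, J, sub_eq_zero] using hl (.inl j) (.inl i)
    · simpa [g, J, sub_eq_zero] using hl (.inr j) (.inr i)
    · simpa [g] using hz (.inl i)
    · simpa [g] using hz (.inr i)
  have hf (t) : RingQuot.liftAlgHom K ⟨FreeAlgebra.lift K g, hg⟩
      (RingQuot.mkAlgHom K (BRel K n) (FreeAlgebra.ι K t)) = g t := by
    rw [RingQuot.liftAlgHom_mkAlgHom_apply, FreeAlgebra.lift_ι_apply]
  refine ⟨RingQuot.liftAlgHom K ⟨FreeAlgebra.lift K g, hg⟩, ?_, hf .Z⟩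
  rintro (i | i)
  · exact hf (.X i)
  · exact hf (.Y i)

theorem algHom_ext {f g : HWeyl K n →ₐ[K] B} (h : ∀ a, f (xy K a) = g (xy K a))
    (hz : f (z K n) = g (z K n)) : f = g := by
  refine RingQuot.ringQuot_ext' K (s := BRel K n) f g (FreeAlgebra.hom_ext (funext ?_))
  rintro (i | i | _)
  · exact h (.inl i)
  · exact h (.inr i)
  · exact hz

theorem IsWeylFamily.map {C : Type*} [Ring C] [Algebra K C] {x : Fin n ⊕ Fin n → B} {w : B}
    (h : IsWeylFamily (K := K) x w) (f : B →ₐ[K] C) :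
    IsWeylFamily (K := K) (fun a => f (x a)) (f w) where
  lie a b := by
    have := congrArg f (h.lie a b)
    simpa [Ring.lie_def] using this
  lie_z a := by
    have := congrArg f (h.lie_z a)
    simpa [Ring.lie_def] using this

/-- The family obtained from `x` and `w` by the affine substitution with linear part `M` and
translation part `ρ`. -/
def affine (M : Matrix (Fin n ⊕ Fin n) (Fin n ⊕ Fin n) K) (ρ : Fin n ⊕ Fin n → K)
    (x : Fin n ⊕ Fin n → B) (w : B) (a : Fin n ⊕ Fin n) : B :=
  ∑ b, M b a • x b + ρ a • w

theorem IsWeylFamily.lie_affine {x : Fin n ⊕ Fin n → B} {w : B}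
    (h : IsWeylFamily (K := K) x w) (M : Matrix (Fin n ⊕ Fin n) (Fin n ⊕ Fin n) K)
    (ρ : Fin n ⊕ Fin n → K) (a b : Fin n ⊕ Fin n) :
    ⁅affine M ρ x w b, affine M ρ x w a⁆ = (Mᵀ * J (Fin n) K * M) a b • w ^ 2 := by
  have lie_smul (c : K) (u v : B) : ⁅u, c • v⁆ = c • ⁅u, v⁆ := by simp [Ring.lie_def, smul_sub]
  have hz (c) : ⁅w, x c⁆ = 0 := by rw [← lie_skew, h.lie_z, neg_zero]
  simp only [affine, add_lie, lie_add, sum_lie, lie_sum, smul_lie, lie_smul, h.lie, h.lie_z, hz,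
    lie_self, smul_zero, Finset.sum_const_zero, add_zero, smul_smul, ← Finset.sum_smul]
  congr 1
  simp only [mul_apply, transpose_apply, Finset.sum_mul, Finset.mul_sum]
  rw [Finset.sum_comm]
  exact Finset.sum_congr rfl fun _ _ => Finset.sum_congr rfl fun _ _ => by ring

theorem IsWeylFamily.affine {x : Fin n ⊕ Fin n → B} {w : B}
    (h : IsWeylFamily (K := K) x w) {M : Matrix (Fin n ⊕ Fin n) (Fin n ⊕ Fin n) K}
    (ρ : Fin n ⊕ Fin n → K) {c : K} (hM : Mᵀ * J (Fin n) K * M = c ^ 2 • J (Fin n) K) :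
    IsWeylFamily (K := K) (affine M ρ x w) (c • w) where
  lie a b := by
    rw [h.lie_affine, hM, Matrix.smul_apply, smul_pow, smul_smul, smul_eq_mul, mul_comm]
  lie_z a := by
    have lie_smul (u v : B) : ⁅u, c • v⁆ = c • ⁅u, v⁆ := by simp [Ring.lie_def, smul_sub]
    simp [HWeyl.affine, sum_lie, lie_smul, h.lie_z]

theorem map_affine {C : Type*} [Ring C] [Algebra K C] (f : B →ₐ[K] C)
    (M : Matrix (Fin n ⊕ Fin n) (Fin n ⊕ Fin n) K)
    (ρ : Fin n ⊕ Fin n → K) (x : Fin n ⊕ Fin n → B) (w : B) (a : Fin n ⊕ Fin n) :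
    f (affine M ρ x w a) = affine M ρ (fun b => f (x b)) (f w) a := by
  simp [affine]

theorem affine_affine (M N : Matrix (Fin n ⊕ Fin n) (Fin n ⊕ Fin n) K)
    (ρ τ : Fin n ⊕ Fin n → K) (c : K) (x : Fin n ⊕ Fin n → B) (w : B) (a : Fin n ⊕ Fin n) :
    affine M ρ (affine N τ x w) (c • w) a = affine (N * M) (Mᵀ *ᵥ τ + c • ρ) x w a := by
  simp only [affine, smul_add, Finset.smul_sum, Finset.sum_add_distrib, mul_apply, smul_smul,
    Finset.sum_smul, Pi.add_apply, Pi.smul_apply, mulVec, dotProduct, transpose_apply, add_smul,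
    smul_eq_mul]
  rw [Finset.sum_comm, add_assoc, mul_comm c]
  simp only [mul_comm (M _ _) (N _ _)]

theorem affine_one_zero (x : Fin n ⊕ Fin n → B) (w : B) (a : Fin n ⊕ Fin n) :
    affine (1 : Matrix (Fin n ⊕ Fin n) (Fin n ⊕ Fin n) K) 0 x w a = x a := by
  simp [affine, one_apply]

end Universal

section Field

variable [Field K]

/-- The representation of the homogenized Weyl algebra by differential operators, on which `Z`
acts as the identity. -/
theorem isWeylFamily_diffOp : IsWeylFamily (K := K)
    (Sum.elim
      (fun i => (MvPolynomial.pderiv i : Derivation K (MvPolynomial (Fin n) K) _).toLinearMap)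
      (fun i => LinearMap.mulLeft K (MvPolynomial.X i)) :
      Fin n ⊕ Fin n → Module.End K (MvPolynomial (Fin n) K)) 1 where
  lie a b := by
    rcases a with i | i <;> rcases b with j | j <;> refine LinearMap.ext fun p => ?_
    · let D (k : Fin n) : Derivation K (MvPolynomial (Fin n) K) (MvPolynomial (Fin n) K) :=
        MvPolynomial.pderiv k
      have h : ⁅D j, D i⁆ = 0 := MvPolynomial.derivation_ext fun k => by
        rw [Derivation.commutator_apply]
        simp [D, MvPolynomial.pderiv_X, Pi.single_apply, apply_ite]
      have := DFunLike.congr_fun h p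
      rw [Derivation.commutator_apply] at this
      simpa [Ring.lie_def, J, D] using this
    · by_cases h : i = j
      · subst h
        simp [Ring.lie_def, J, MvPolynomial.pderiv_X]
      · simp [Ring.lie_def, J, MvPolynomial.pderiv_X, one_apply, h, Ne.symm h]
    · by_cases h : i = j
      · subst h
        simp [Ring.lie_def, J, MvPolynomial.pderiv_X]
      · simp [Ring.lie_def, J, MvPolynomial.pderiv_X, one_apply, h]
    · simp [Ring.lie_def, J, mul_left_comm]
  lie_z a := by simp [Ring.lie_def]

theorem smul_z_sq_injective : Function.Injective fun c : K => c • z K n ^ 2 := by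
  obtain ⟨f, -, hf⟩ := exists_algHom (isWeylFamily_diffOp (K := K) (n := n))
  intro c d h
  have := congrArg f h
  simp only [map_smul, map_pow, hf, one_pow] at this
  exact smul_left_injective K (one_ne_zero (α := Module.End K (MvPolynomial (Fin n) K))) this

/-- An affine substitution `x_a ↦ ∑_b M_{ba} x_b + ρ_a Z`, `Z ↦ c Z` extends to an automorphism
exactly when `M` is a symplectic similitude with multiplier `c ^ 2`. -/
theorem exists_algEquiv_affine_iff (M : Matrix (Fin n ⊕ Fin n) (Fin n ⊕ Fin n) K)
    (ρ : Fin n ⊕ Fin n → K) {c : K} (hc : c ≠ 0) :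
    (∃ σ : HWeyl K n ≃ₐ[K] HWeyl K n,
      (∀ a, σ (xy K a) = affine M ρ (xy K) (z K n) a) ∧ σ (z K n) = c • z K n) ↔
    Mᵀ * J (Fin n) K * M = c ^ 2 • J (Fin n) K := by
  constructor
  · rintro ⟨σ, hσ, hz⟩
    ext a b
    apply smul_z_sq_injective (n := n)
    have h := (isWeylFamily_xy.map (σ : HWeyl K n →ₐ[K] HWeyl K n)).lie a b
    simp only [AlgEquiv.coe_toAlgHom, hσ, hz] at h
    rw [isWeylFamily_xy.lie_affine, smul_pow, smul_smul, mul_comm] at h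
    exact h
  · intro hM
    set N := -((c ^ 2)⁻¹ • (J (Fin n) K * Mᵀ * J (Fin n) K)) with hN
    have hNM : N * M = 1 := by
      rw [hN, neg_mul, smul_mul_assoc, mul_assoc, mul_assoc, ← mul_assoc Mᵀ, hM, mul_smul_comm,
        J_squared, smul_smul, inv_mul_cancel₀ (pow_ne_zero 2 hc), one_smul, neg_neg]
    have hMN : M * N = 1 := mul_eq_one_comm.mp hNM
    have hN' : Nᵀ * J (Fin n) K * N = c⁻¹ ^ 2 • J (Fin n) K := by
      have h1 : Nᵀ * (Mᵀ * J (Fin n) K * M) * N = J (Fin n) K := by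
        calc Nᵀ * (Mᵀ * J (Fin n) K * M) * N = (M * N)ᵀ * J (Fin n) K * (M * N) := by
              simp only [transpose_mul, mul_assoc]
          _ = J (Fin n) K := by simp [hMN]
      rw [hM, mul_smul_comm, smul_mul_assoc] at h1
      rw [← h1, smul_smul, ← mul_pow, inv_mul_cancel₀ hc, one_pow, one_smul, h1]
    obtain ⟨f, hf, hfz⟩ := exists_algHom (isWeylFamily_xy.affine ρ hM)
    obtain ⟨g, hg, hgz⟩ := exists_algHom
      (isWeylFamily_xy.affine (-(c⁻¹ • (Nᵀ *ᵥ ρ))) hN')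
    refine ⟨AlgEquiv.ofAlgHom f g (algHom_ext (fun a => ?_) ?_) (algHom_ext (fun a => ?_) ?_),
      hf, hfz⟩
    · simp only [AlgHom.comp_apply, hg, map_affine, hf, hfz]
      rw [affine_affine, hMN, smul_neg, smul_smul, mul_inv_cancel₀ hc, one_smul,
        add_neg_cancel, affine_one_zero, AlgHom.id_apply]
    · simp [hgz, hfz, smul_smul, hc]
    · simp only [AlgHom.comp_apply, hf, map_affine, hg, hgz]
      rw [affine_affine, hNM, mulVec_neg, mulVec_smul, mulVec_mulVec, ← transpose_mul, hNM,
        transpose_one, one_mulVec, neg_add_cancel, affine_one_zero, AlgHom.id_apply]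
    · simp [hgz, hfz, smul_smul, hc]

end Field

theorem transpose_mul_J_mul_apply [CommRing K] (M : Matrix (Fin n ⊕ Fin n) (Fin n ⊕ Fin n) K)
    (a b : Fin n ⊕ Fin n) :
    (Mᵀ * J (Fin n) K * M) a b =
      -∑ i, (M (.inl i) a * M (.inr i) b - M (.inl i) b * M (.inr i) a) := by
  simp only [mul_apply, Fintype.sum_sum_type, J, transpose_apply, fromBlocks_apply₁₁,
    fromBlocks_apply₁₂, fromBlocks_apply₂₁, fromBlocks_apply₂₂, one_apply, Matrix.neg_apply,
    Matrix.zero_apply, mul_zero, Finset.sum_const_zero, zero_add, add_zero, mul_ite, mul_neg,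
    mul_one, Finset.sum_neg_distrib, Finset.sum_ite_eq', Finset.mem_univ, if_true,
    neg_mul, sub_eq_add_neg, mul_comm (M (.inl _) b), Finset.sum_add_distrib, neg_add_rev, neg_neg]

end HWeyl

/-- Let `K` be a field of characteristic zero, `n ≥ 1`, and `B_n` the
homogenized Weyl algebra over `K`.  Given a `2n × 2n` matrix `A` over `K`, vectors
`μ, ν ∈ K^n` (together forming `ρ = (μ₁,…,μₙ,ν₁,…,νₙ)`), and `0 ≠ λ ∈ K`, the assignment
`σ(X_j) = ∑ᵢ A_{2i−1,2j−1}·X_i + ∑ᵢ A_{2i,2j−1}·Y_i + μ_j·Z`,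
`σ(Y_k) = ∑ᵢ A_{2i−1,2k}·X_i + ∑ᵢ A_{2i,2k}·Y_i + ν_k·Z`, `σ(Z) = λ·Z`
extends to a `K`-algebra automorphism of `B_n` if and only if conditions (1)–(4) on the
`2 × 2` minors of `A` hold. -/
theorem hweyl_extends_to_automorphism_iff
    (K : Type) [Field K] [CharZero K] (n : ℕ) (hn : 1 ≤ n)
    (A : Matrix (Fin (2 * n)) (Fin (2 * n)) K) (μ ν : Fin n → K)
    (lam : K) (hlam : lam ≠ 0) :
    (∃ σ : HWeyl K n ≃ₐ[K] HWeyl K n,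
      (∀ j : Fin n, σ (HWeyl.gen K (BGen.X j))
          = (∑ i : Fin n, A (oddIdx i) (oddIdx j) • HWeyl.gen K (BGen.X i))
            + (∑ i : Fin n, A (evenIdx i) (oddIdx j) • HWeyl.gen K (BGen.Y i))
            + μ j • HWeyl.gen K (BGen.Z : BGen n)) ∧
      (∀ k : Fin n, σ (HWeyl.gen K (BGen.Y k))
          = (∑ i : Fin n, A (oddIdx i) (evenIdx k) • HWeyl.gen K (BGen.X i))
            + (∑ i : Fin n, A (evenIdx i) (evenIdx k) • HWeyl.gen K (BGen.Y i))
            + ν k • HWeyl.gen K (BGen.Z : BGen n)) ∧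
      σ (HWeyl.gen K (BGen.Z : BGen n)) = lam • HWeyl.gen K (BGen.Z : BGen n))
    ↔ ((∀ j k : Fin n, j < k →
          (∑ i : Fin n, (A (oddIdx i) (oddIdx j) * A (evenIdx i) (oddIdx k)
            - A (oddIdx i) (oddIdx k) * A (evenIdx i) (oddIdx j))) = 0) ∧
        (∀ j k : Fin n, j < k →
          (∑ i : Fin n, (A (oddIdx i) (evenIdx j) * A (evenIdx i) (evenIdx k)
            - A (oddIdx i) (evenIdx k) * A (evenIdx i) (evenIdx j))) = 0) ∧
        (∀ j : Fin n,
          (∑ i : Fin n, (A (oddIdx i) (oddIdx j) * A (evenIdx i) (evenIdx j)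
            - A (oddIdx i) (evenIdx j) * A (evenIdx i) (oddIdx j))) = lam ^ 2) ∧
        (∀ j k : Fin n, j ≠ k →
          (∑ i : Fin n, (A (oddIdx i) (oddIdx j) * A (evenIdx i) (evenIdx k)
            - A (oddIdx i) (evenIdx k) * A (evenIdx i) (oddIdx j))) = 0)) := by
  let idx : Fin n ⊕ Fin n → Fin (2 * n) := Sum.elim oddIdx evenIdx
  have key := HWeyl.exists_algEquiv_affine_iff (A.submatrix idx idx) (Sum.elim μ ν) hlam
  simp only [Sum.forall, HWeyl.affine, Fintype.sum_sum_type, Matrix.submatrix_apply, idx,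
    Sum.elim_inl, Sum.elim_inr, HWeyl.xy, HWeyl.z, and_assoc] at key
  rw [key, ← Matrix.ext_iff]
  simp only [HWeyl.transpose_mul_J_mul_apply]
  simp only [Sum.forall, Matrix.submatrix_apply, Sum.elim_inl,
    Sum.elim_inr, Matrix.smul_apply, Matrix.J, Matrix.fromBlocks_apply₁₁,
    Matrix.fromBlocks_apply₁₂, Matrix.fromBlocks_apply₂₁, Matrix.fromBlocks_apply₂₂,
    Matrix.zero_apply, Matrix.neg_apply, smul_eq_mul, mul_zero, mul_neg, neg_inj, neg_eq_zero]
  have skew (p q r s : Fin n → K) :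
      ∑ i, (p i * q i - r i * s i) = -∑ i, (r i * s i - p i * q i) := by
    simp
  have extend {F : Fin n → Fin n → K} (hF : ∀ j k, F j k = -F k j) (hd : ∀ j, F j j = 0)
      (h : ∀ j k, j < k → F j k = 0) (j k : Fin n) : F j k = 0 := by
    rcases lt_trichotomy j k with hjk | rfl | hjk
    · exact h j k hjk
    · exact hd j
    · rw [hF, h k j hjk, neg_zero]
  constructor
  · rintro ⟨h1, h2⟩
    refine ⟨fun j k _ => (h1 j).1 k, fun j k _ => (h2 j).2 k, fun j => ?_, fun j k hjk => ?_⟩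
    · simpa using (h1 j).2 j
    · simpa [Matrix.one_apply, hjk] using (h1 j).2 k
  · rintro ⟨h1, h2, h3, h4⟩
    have hxy (j k : Fin n) : ∑ i, (A (oddIdx i) (oddIdx j) * A (evenIdx i) (evenIdx k)
        - A (oddIdx i) (evenIdx k) * A (evenIdx i) (oddIdx j))
        = lam ^ 2 * (1 : Matrix (Fin n) (Fin n) K) j k := by
      by_cases hjk : j = k
      · subst hjk
        simpa using h3 j
      · simpa [Matrix.one_apply, hjk] using h4 j k hjk
    refine ⟨fun j => ⟨extend (fun _ _ => skew _ _ _ _) (fun _ => by simp) h1 j, hxy j⟩,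
      fun j => ⟨fun k => ?_, extend (fun _ _ => skew _ _ _ _) (fun _ => by simp) h2 j⟩⟩
    rw [← skew, hxy k j, Matrix.one_apply, Matrix.one_apply]
    simp only [eq_comm]
end
end

section
/- Let K be an infinite field of characteristic zero, n ≥ 1, and B_n the homogenized Weyl algebra over K. Then the intersection over all c ∈ K of the ideals (Z − c)·B_n is zero: ⋂_{c∈K} (Z − c)B_n = {0}. (Note that Z is central in B_n, so each (Z − c)B_n is a two-sided ideal.) -/
/-! Prelude: the homogenized Weyl algebra `B_n`. -/

noncomputable section

open scoped TensorProduct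

open scoped IsMulCommutative in
/-- A commuting family in an algebra, possibly noncommutative, is the image of the variables under
an algebra homomorphism from a polynomial ring. -/
theorem MvPolynomial.exists_algHom_of_commute {K A ι : Type*} [CommRing K] [Ring A] [Algebra K A]
    (v : ι → A) (hv : ∀ i j, Commute (v i) (v j)) :
    ∃ f : MvPolynomial ι K →ₐ[K] A, ∀ i, f (MvPolynomial.X i) = v i := by
  have hcomm : ∀ a ∈ Set.range v, ∀ b ∈ Set.range v, a * b = b * a := by
    rintro _ ⟨i, rfl⟩ _ ⟨j, rfl⟩
    exact hv i j
  have := Algebra.isMulCommutative_adjoin K hcomm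
  refine ⟨(Algebra.adjoin K (Set.range v)).val.comp
    (MvPolynomial.aeval fun i => (⟨v i, Algebra.subset_adjoin ⟨i, rfl⟩⟩ :
      Algebra.adjoin K (Set.range v))), fun i => ?_⟩
  simp

/-- Over an infinite field, zero is the only polynomial divisible by `X i - c` for every
constant `c`. -/
theorem MvPolynomial.eq_zero_of_forall_X_none_sub_C_dvd {K ι : Type*} [Field K] [Infinite K]
    (p : MvPolynomial (Option ι) K)
    (hp : ∀ c : K, (MvPolynomial.X none - MvPolynomial.C c) ∣ p) : p = 0 := by
  rw [← map_eq_zero_iff (MvPolynomial.optionEquivLeft K ι)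
    (MvPolynomial.optionEquivLeft K ι).injective]
  refine Polynomial.eq_zero_of_infinite_isRoot _ (Set.Infinite.mono ?_
    (Set.infinite_range_of_injective (MvPolynomial.C_injective ι K)))
  rintro _ ⟨c, rfl⟩
  have h := map_dvd (MvPolynomial.optionEquivLeft K ι) (hp c)
  rw [map_sub, MvPolynomial.optionEquivLeft_X_none, MvPolynomial.optionEquivLeft_C] at h
  exact Polynomial.dvd_iff_isRoot.mp h

/-- Partial derivatives commute. -/
theorem MvPolynomial.pderiv_comm {K ι : Type*} [CommRing K] (i j : ι) (s : MvPolynomial ι K) :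
    MvPolynomial.pderiv i (MvPolynomial.pderiv j s) =
      MvPolynomial.pderiv j (MvPolynomial.pderiv i s) := by
  have h : ⁅MvPolynomial.pderiv (R := K) i, MvPolynomial.pderiv (R := K) j⁆ = 0 := by
    classical
    refine MvPolynomial.derivation_ext fun k => ?_
    rw [Derivation.commutator_apply, MvPolynomial.pderiv_X, MvPolynomial.pderiv_X]
    simp [Pi.single_apply, apply_ite]
  have h' := DFunLike.congr_fun h s
  rw [Derivation.commutator_apply] at h'
  exact sub_eq_zero.mp h'

namespace HWeyl

section Relations

variable (K : Type) [CommRing K] {n : ℕ}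

theorem gen_X_mul_gen_Y (i j : Fin n) :
    gen K (BGen.X i) * gen K (BGen.Y j) = gen K (BGen.Y j) * gen K (BGen.X i) +
      if i = j then (gen K (BGen.Z : BGen n)) ^ 2 else 0 := by
  have h := RingQuot.mkAlgHom_rel K (BRel.xy (K := K) i j)
  rw [map_add, map_mul, map_mul, apply_ite (RingQuot.mkAlgHom K (BRel K n)), map_pow, map_zero] at h
  exact h

theorem commute_gen_X_X (i j : Fin n) : Commute (gen K (BGen.X i)) (gen K (BGen.X j)) := by
  have h := RingQuot.mkAlgHom_rel K (BRel.xx (K := K) i j)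
  rw [map_mul, map_mul] at h
  exact h

theorem commute_gen_Y_Y (i j : Fin n) : Commute (gen K (BGen.Y i)) (gen K (BGen.Y j)) := by
  have h := RingQuot.mkAlgHom_rel K (BRel.yy (K := K) i j)
  rw [map_mul, map_mul] at h
  exact h

theorem commute_gen_X_Z (i : Fin n) : Commute (gen K (BGen.X i)) (gen K BGen.Z) := by
  have h := RingQuot.mkAlgHom_rel K (BRel.xz (K := K) i)
  rw [map_mul, map_mul] at h
  exact h

theorem commute_gen_Y_Z (i : Fin n) : Commute (gen K (BGen.Y i)) (gen K BGen.Z) := by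
  have h := RingQuot.mkAlgHom_rel K (BRel.yz (K := K) i)
  rw [map_mul, map_mul] at h
  exact h

/-- The subalgebra generated by the `X_i` and `Z` is a quotient of a polynomial ring. -/
theorem exists_algHom_XZ (n : ℕ) : ∃ g : MvPolynomial (Option (Fin n)) K →ₐ[K] HWeyl K n,
    g (MvPolynomial.X none) = gen K BGen.Z ∧
      ∀ i, g (MvPolynomial.X (some i)) = gen K (BGen.X i) := by
  obtain ⟨g, hg⟩ := MvPolynomial.exists_algHom_of_commute (K := K)
    (fun o : Option (Fin n) => o.elim (gen K BGen.Z) fun i => gen K (BGen.X i)) (by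
      rintro (_ | i) (_ | j)
      · exact Commute.refl _
      · exact (commute_gen_X_Z K j).symm
      · exact commute_gen_X_Z K i
      · exact commute_gen_X_X K i j)
  exact ⟨g, hg none, fun i => hg (some i)⟩

/-- The subalgebra generated by the `Y_i` is a quotient of a polynomial ring, on which
commutation with `X_i` is `Z²` times the `i`-th partial derivative. -/
theorem exists_algHom_Y (n : ℕ) : ∃ f : MvPolynomial (Fin n) K →ₐ[K] HWeyl K n,
    (∀ i, f (MvPolynomial.X i) = gen K (BGen.Y i)) ∧
    (∀ p, Commute (f p) (gen K BGen.Z)) ∧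
    ∀ i p, gen K (BGen.X i) * f p =
      f p * gen K (BGen.X i) + f (MvPolynomial.pderiv i p) * gen K BGen.Z ^ 2 := by
  obtain ⟨f, hf⟩ := MvPolynomial.exists_algHom_of_commute (K := K) _ (commute_gen_Y_Y K (n := n))
  have hZ : ∀ p, Commute (f p) (gen K BGen.Z) := by
    intro p
    induction p using MvPolynomial.induction_on with
    | C a => exact (f.commutes a).symm ▸ Algebra.commute_algebraMap_left a _
    | add p q hp hq => exact (map_add f p q).symm ▸ hp.add_left hq
    | mul_X p j hp =>
      rw [map_mul, hf]
      exact hp.mul_left (commute_gen_Y_Z K j)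
  refine ⟨f, hf, hZ, fun i p => ?_⟩
  induction p using MvPolynomial.induction_on with
  | C a =>
    rw [MvPolynomial.pderiv_C, map_zero, zero_mul, add_zero]
    exact (f.commutes a).symm ▸ (Algebra.commute_algebraMap_right a _)
  | add p q hp hq =>
    simp only [map_add, mul_add, add_mul, hp, hq]
    abel
  | mul_X p j hp =>
    have hYZ : gen K BGen.Z ^ 2 * gen K (BGen.Y j) = gen K (BGen.Y j) * gen K BGen.Z ^ 2 :=
      ((commute_gen_Y_Z K j).pow_right 2).eq.symm
    rw [Derivation.leibniz, MvPolynomial.pderiv_X, map_mul, hf, ← mul_assoc, hp, add_mul,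
      mul_assoc (f p), gen_X_mul_gen_Y, mul_assoc (f _) (gen K BGen.Z ^ 2), hYZ, smul_eq_mul,
      smul_eq_mul, map_add, map_mul, map_mul, hf, mul_add, add_mul, ← mul_assoc, ← mul_assoc,
      ← hf j, ← map_mul f (MvPolynomial.X j), mul_comm (MvPolynomial.X j), map_mul]
    by_cases hij : i = j
    · subst hij
      simp only [if_true, Pi.single_eq_same, map_one, mul_one]
      abel
    · have hji : j ≠ i := fun h => hij h.symm
      simp [hij, hji]

end Relations

section Representation

variable (K : Type) [CommRing K] (n : ℕ)

/-- The `K[x, z]`-module `K[x, z] ⊗ K[y]` on which the homogenized Weyl algebra acts. -/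
abbrev Model : Type := MvPolynomial (Option (Fin n)) K ⊗[K] MvPolynomial (Fin n) K

variable {n}

/-- The action of the generators on `K[x, z] ⊗ K[y]`: `Y_i` and `Z` act by multiplication, and
`X_i` acts as `x_i + z² ∂/∂y_i`. -/
def genAction : BGen n → Module.End K (Model K n)
  | BGen.X i =>
    TensorProduct.map (LinearMap.mulLeft K (MvPolynomial.X (some i))) LinearMap.id +
      TensorProduct.map (LinearMap.mulLeft K (MvPolynomial.X none ^ 2))
        (MvPolynomial.pderiv i).toLinearMap
  | BGen.Y i => TensorProduct.map LinearMap.id (LinearMap.mulLeft K (MvPolynomial.X i))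
  | BGen.Z => TensorProduct.map (LinearMap.mulLeft K (MvPolynomial.X none)) LinearMap.id

@[simp]
theorem genAction_X_tmul (i : Fin n) (r : MvPolynomial (Option (Fin n)) K)
    (s : MvPolynomial (Fin n) K) :
    genAction K (BGen.X i) (r ⊗ₜ s) = (MvPolynomial.X (some i) * r) ⊗ₜ[K] s +
      (MvPolynomial.X none ^ 2 * r) ⊗ₜ[K] MvPolynomial.pderiv i s := rfl

@[simp]
theorem genAction_Y_tmul (i : Fin n) (r : MvPolynomial (Option (Fin n)) K)
    (s : MvPolynomial (Fin n) K) :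
    genAction K (BGen.Y i) (r ⊗ₜ s) = r ⊗ₜ[K] (MvPolynomial.X i * s) := rfl

@[simp]
theorem genAction_Z_tmul (r : MvPolynomial (Option (Fin n)) K) (s : MvPolynomial (Fin n) K) :
    genAction K BGen.Z (r ⊗ₜ s) = (MvPolynomial.X none * r) ⊗ₜ[K] s := rfl

theorem genAction_Z_apply (t : Model K n) :
    genAction K BGen.Z t = (MvPolynomial.X none : MvPolynomial (Option (Fin n)) K) • t := by
  induction t using TensorProduct.induction_on with
  | zero => simp
  | tmul r s => simp [TensorProduct.smul_tmul']
  | add t u ht hu => rw [map_add, ht, hu, smul_add]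

theorem lift_genAction_rel ⦃a b : FreeAlgebra K (BGen n)⦄ (h : BRel K n a b) :
    FreeAlgebra.lift K (genAction K) a = FreeAlgebra.lift K (genAction K) b := by
  induction h with
  | xy i j =>
    rw [map_add, apply_ite (FreeAlgebra.lift K (genAction K))]
    simp only [map_mul, map_pow, map_zero, FreeAlgebra.lift_ι_apply]
    refine TensorProduct.ext' fun r s => ?_
    by_cases hij : i = j
    · subst hij
      simp [TensorProduct.tmul_add, pow_two, mul_assoc, add_assoc]
    · have hji : j ≠ i := fun h => hij h.symm
      simp [hij, hji]
  | xx i j =>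
    simp only [map_mul, FreeAlgebra.lift_ι_apply]
    refine TensorProduct.ext' fun r s => ?_
    simp only [Module.End.mul_apply, genAction_X_tmul, map_add, MvPolynomial.pderiv_comm i j,
      mul_left_comm (MvPolynomial.X (some i)) (MvPolynomial.X (some j)),
      mul_left_comm (MvPolynomial.X none ^ 2) (MvPolynomial.X (some _))]
    abel
  | yy i j =>
    simp only [map_mul, FreeAlgebra.lift_ι_apply]
    refine TensorProduct.ext' fun r s => ?_
    simp [mul_left_comm]
  | xz i =>
    simp only [map_mul, FreeAlgebra.lift_ι_apply]
    refine TensorProduct.ext' fun r s => ?_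
    simp [mul_left_comm]
  | yz i =>
    simp only [map_mul, FreeAlgebra.lift_ι_apply]
    refine TensorProduct.ext' fun r s => ?_
    simp

/-- The action of the homogenized Weyl algebra on `K[x, z] ⊗ K[y]`. -/
def action : HWeyl K n →ₐ[K] Module.End K (Model K n) :=
  RingQuot.liftAlgHom K ⟨FreeAlgebra.lift K (genAction K), lift_genAction_rel K⟩

@[simp]
theorem action_gen (w : BGen n) : action K (gen K w) = genAction K w := by
  have h := RingQuot.liftAlgHom_mkAlgHom_apply (S := K) (FreeAlgebra.lift K (genAction K))
    (lift_genAction_rel K (n := n)) (FreeAlgebra.ι K w)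
  rw [FreeAlgebra.lift_ι_apply] at h
  exact h

variable {K}

@[elab_as_elim]
theorem gen_mul_induction {P : HWeyl K n → Prop} (b : HWeyl K n)
    (one : P 1) (smul : ∀ (c : K) b, P b → P (c • b)) (add : ∀ b b', P b → P b' → P (b + b'))
    (gen_mul : ∀ w b, P b → P (gen K w * b)) : P b := by
  obtain ⟨a, rfl⟩ := RingQuot.mkAlgHom_surjective K (BRel K n) b
  have key : ∀ b : HWeyl K n, P b → P ((show HWeyl K n from RingQuot.mkAlgHom K (BRel K n) a) * b) := by
    induction a with
    | grade0 c =>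
      intro b hb
      rw [AlgHom.commutes]
      exact Algebra.smul_def c b ▸ smul c b hb
    | grade1 w => exact fun b hb => gen_mul w b hb
    | add a a' ha ha' =>
      intro b hb
      rw [map_add]
      exact (add_mul _ _ b : _ = _).symm ▸ add _ _ (ha b hb) (ha' b hb)
    | mul a a' ha ha' =>
      intro b hb
      rw [map_mul]
      exact (mul_assoc _ _ b : _ = _).symm ▸ ha _ (ha' b hb)
  have h := key 1 one
  rwa [mul_one] at h

/-- Acting on `1` embeds the homogenized Weyl algebra into `K[x, z] ⊗ K[y]`. -/
theorem action_apply_one_injective :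
    Function.Injective fun b : HWeyl K n => action K b (1 : Model K n) := by
  obtain ⟨g, hgZ, hgX⟩ := exists_algHom_XZ K n
  obtain ⟨f, hfY, hfZ, hfX⟩ := exists_algHom_Y K n
  let ψ : Model K n →ₗ[K] HWeyl K n :=
    TensorProduct.lift ((LinearMap.mul K (HWeyl K n)).flip.compl₁₂ g.toLinearMap f.toLinearMap)
  have hψ : ∀ r s, ψ (r ⊗ₜ s) = f s * g r := fun r s => rfl
  have hgen : ∀ w t, ψ (genAction K w t) = gen K w * ψ t := by
    intro w t
    induction t using TensorProduct.induction_on with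
    | zero => simp
    | add t u ht hu => rw [map_add, map_add, ht, hu, map_add, mul_add]
    | tmul r s =>
      cases w with
      | X i =>
        rw [genAction_X_tmul, map_add, hψ, hψ, hψ, map_mul, map_mul, map_pow, hgZ, hgX,
          ← mul_assoc (gen K _), hfX, add_mul, mul_assoc, mul_assoc]
      | Y i => rw [genAction_Y_tmul, hψ, hψ, map_mul, hfY, mul_assoc]
      | Z => rw [genAction_Z_tmul, hψ, hψ, map_mul, hgZ, ← mul_assoc, (hfZ s).eq, mul_assoc]
  refine Function.LeftInverse.injective (g := ψ) fun b => ?_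
  induction b using gen_mul_induction with
  | one =>
    rw [map_one (action K), Module.End.one_apply, Algebra.TensorProduct.one_def, hψ, map_one, map_one, mul_one]
  | smul c b hb => rw [map_smul, LinearMap.smul_apply, map_smul, hb]
  | add b b' hb hb' => rw [map_add, LinearMap.add_apply, map_add, hb, hb']
  | gen_mul w b hb => rw [map_mul, Module.End.mul_apply, action_gen, hgen, hb]

end Representation

end HWeyl

/-- Let `K` be an infinite field of characteristic zero and `B_n` the
homogenized Weyl algebra over `K`.  Then `⋂_{c ∈ K} (Z - c)·B_n = 0`
(`Z` is central in `B_n`, so each `(Z - c)B_n` is a two-sided ideal). -/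
theorem hweyl_iInter_Z_sub_c_eq_bot (K : Type) [Field K] [Infinite K] [CharZero K]
    (n : ℕ) (hn : 1 ≤ n) (b : HWeyl K n)
    (hb : ∀ c : K, ∃ q : HWeyl K n, b = (HWeyl.gen K (BGen.Z : BGen n) - algebraMap K _ c) * q) :
    b = 0 := by
  apply HWeyl.action_apply_one_injective
  let B := Algebra.TensorProduct.basis (MvPolynomial (Option (Fin n)) K)
    (MvPolynomial.basisMonomials (Fin n) K)
  refine B.repr.injective (Finsupp.ext fun a => ?_)
  change B.repr (HWeyl.action K b 1) a = B.repr (HWeyl.action K 0 1) a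
  rw [map_zero, LinearMap.zero_apply, map_zero, Finsupp.zero_apply]
  refine MvPolynomial.eq_zero_of_forall_X_none_sub_C_dvd _ fun c => ?_
  obtain ⟨q, rfl⟩ := hb c
  have h : HWeyl.action K ((HWeyl.gen K BGen.Z - algebraMap K _ c) * q) (1 : HWeyl.Model K n) =
      (MvPolynomial.X none - MvPolynomial.C c : MvPolynomial (Option (Fin n)) K) •
        HWeyl.action K q (1 : HWeyl.Model K n) := by
    rw [map_mul, Module.End.mul_apply, map_sub, LinearMap.sub_apply, HWeyl.action_gen,
      HWeyl.genAction_Z_apply, AlgHom.commutes, Module.algebraMap_end_apply,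
      ← algebraMap_smul (MvPolynomial (Option (Fin n)) K) c, MvPolynomial.algebraMap_eq]
    exact (sub_smul _ _ _).symm
  rw [h, map_smul, Finsupp.smul_apply, smul_eq_mul]
  exact dvd_mul_right _ _
end
end
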